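/- The modal logic Grz.2 is characterized by the class of all finite Boolean algebras: a propositional modal formula is provable in Grz.2 if and only if it is valid in every Kripke frame that is a finite Boolean algebra (with accessibility relation ≤). -/

import Mathlib

namespace GrzPaper

/-- Propositional modal formulas, built from variables, falsum, implication and box. -/
inductive Formula : Type
  | var : ℕ → Formula
  | fls : Formula
  | impl : Formula → Formula → Formula
  | box : Formula → Formula
deriving DecidableEq

namespace Formula

def neg (φ : Formula) : Formula := impl φ fls
def tru : Formula := neg fls
def disj (φ ψ : Formula) : Formula := impl (neg φ) ψ
def conj (φ ψ : Formula) : Formula := neg (impl φ (neg ψ))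
def dia (φ : Formula) : Formula := neg (box (neg φ))

/-- Uniform substitution. -/
def subst (σ : ℕ → Formula) : Formula → Formula
  | var n => σ n
  | fls => fls
  | impl a b => impl (subst σ a) (subst σ b)
  | box a => box (subst σ a)

/-- Propositional (Boolean) evaluation, treating variables and boxed formulas as atoms. -/
def evalProp (v : Formula → Bool) : Formula → Bool
  | var n => v (var n)
  | fls => false
  | impl a b => !(evalProp v a) || evalProp v b
  | box a => v (box a)

/-- A propositional tautology: true under every Boolean valuation of the atoms
(variables and boxed subformulas). -/
def Tautology (φ : Formula) : Prop := ∀ v, evalProp v φ = true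

end Formula

open Formula

/-- A normal modal logic: contains all propositional tautologies and all instances of K,
closed under modus ponens, necessitation and uniform substitution. -/
structure IsNormalLogic (L : Set Formula) : Prop where
  taut : ∀ φ, Tautology φ → φ ∈ L
  axK : ∀ φ ψ, impl (box (impl φ ψ)) (impl (box φ) (box ψ)) ∈ L
  mp : ∀ φ ψ, impl φ ψ ∈ L → φ ∈ L → ψ ∈ L
  nec : ∀ φ, φ ∈ L → box φ ∈ L
  subst : ∀ φ σ, φ ∈ L → φ.subst σ ∈ L

/-- The normal modal logic generated by a set of axioms: the smallest normal modal
logic containing them. -/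
def Generated (Ax : Set Formula) : Set Formula :=
  ⋂₀ {L | IsNormalLogic L ∧ Ax ⊆ L}

def pv : Formula := var 0
def qv : Formula := var 1

def axT : Formula := impl (box pv) pv
def axFour : Formula := impl (box pv) (box (box pv))
def axGrz : Formula := impl (box (impl (box (impl pv (box pv))) pv)) pv
def axPoint2 : Formula := impl (dia (box pv)) (box (dia pv))
def axPoint3 : Formula := disj (box (impl (box pv) qv)) (box (impl (box qv) pv))

/-- penultimate(φ) : φ ∧ ◇¬φ ∧ □(¬φ → □¬φ). -/
def penultimate (φ : Formula) : Formula :=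
  conj φ (conj (dia (neg φ)) (box (impl (neg φ) (box (neg φ)))))

/-- contingent(φ) : ◇φ ∧ ◇¬φ. -/
def contingent (φ : Formula) : Formula := conj (dia φ) (dia (neg φ))

/-- The axiom Grz* : contingent(p) → ◇(penultimate(p) ∨ penultimate(¬p)). -/
def axGrzStar : Formula :=
  impl (contingent pv) (dia (disj (penultimate pv) (penultimate (neg pv))))

def Grz : Set Formula := Generated {axGrz}
def GrzStarLogic : Set Formula := Generated {axGrzStar}
def S4GrzStar : Set Formula := Generated {axT, axFour, axGrzStar}
def Grz2 : Set Formula := Generated {axGrz, axPoint2}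
def Grz3 : Set Formula := Generated {axGrz, axPoint3}
def KLogic : Set Formula := Generated ∅

/-- A Kripke model: an accessibility relation together with a valuation. -/
structure KripkeModel (W : Type) where
  rel : W → W → Prop
  val : ℕ → W → Prop

/-- Satisfaction of a modal formula at a world of a Kripke model. -/
def Satisfies {W : Type} (M : KripkeModel W) : W → Formula → Prop
  | w, .var n => M.val n w
  | _, .fls => False
  | w, .impl a b => Satisfies M w a → Satisfies M w b
  | w, .box a => ∀ v, M.rel w v → Satisfies M v a

/-- Validity of a formula on a Kripke frame. -/
def ValidOnFrame (W : Type) (R : W → W → Prop) (φ : Formula) : Prop :=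
  ∀ (val : ℕ → W → Prop) (w : W), Satisfies ⟨R, val⟩ w φ

/-- A model labeling of (M,w₀) for (N,u₀): a substitution σ such that every formula is
true at (M,w₀) iff its σ-instance is true at (N,u₀). -/
def ModelLabeling {W U : Type} (M : KripkeModel W) (w0 : W) (N : KripkeModel U) (u0 : U)
    (σ : ℕ → Formula) : Prop :=
  ∀ φ : Formula, Satisfies M w0 φ ↔ Satisfies N u0 (φ.subst σ)

/-- A frame labeling of the frame (W,R) with initial node w₀ for the pointed model (N,u₀). -/
def FrameLabeling {W U : Type} (R : W → W → Prop) (w0 : W) (N : KripkeModel U) (u0 : U)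
    (Φ : W → Formula) : Prop :=
  Satisfies N u0 (Φ w0) ∧
  (∀ u, N.rel u0 u → ∀ w, Satisfies N u (Φ w) →
    ∀ w', (Satisfies N u (dia (Φ w')) ↔ R w w')) ∧
  (∀ u, N.rel u0 u → ∃! w, Satisfies N u (Φ w))

def bigOr : List Formula → Formula
  | [] => fls
  | φ :: l => disj φ (bigOr l)

def bigAnd : List Formula → Formula
  | [] => tru
  | φ :: l => conj φ (bigAnd l)

open Classical in
/-- The disjunction ⋁ {Φ w : P w}. -/
noncomputable def labelFormula {W : Type} [Fintype W] (Φ : W → Formula) (P : W → Prop) :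
    Formula :=
  bigOr ((Finset.univ.filter P).toList.map Φ)

/-- Θ_A : the formula asserting that the button pattern is exactly A. -/
noncomputable def Theta {n : ℕ} (b : Fin n → Formula) (A : Finset (Fin n)) : Formula :=
  bigAnd ((Finset.univ : Finset (Fin n)).toList.map
    (fun i => if i ∈ A then box (b i) else neg (box (b i))))

/-- b₀,…,b_{n−1} are independent buttons at u₀: none is pushed (necessary) at u₀, and
necessarily, whenever the button pattern is exactly A, every larger pattern is possible. -/
def IndependentButtons {U : Type} (N : KripkeModel U) (u0 : U) {n : ℕ}
    (b : Fin n → Formula) : Prop :=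
  (∀ i, ¬ Satisfies N u0 (box (b i))) ∧
  ∀ A : Finset (Fin n), ∀ u, N.rel u0 u → Satisfies N u (Theta b A) →
    ∀ A' : Finset (Fin n), A ⊆ A' → Satisfies N u (dia (Theta b A'))

/-- r₀,…,r_{n−1} form a ratchet of length n at u₀. -/
def Ratchet {U : Type} (N : KripkeModel U) (u0 : U) {n : ℕ} (r : Fin n → Formula) : Prop :=
  (∀ i : Fin n, (i.val = 0 → Satisfies N u0 (box (r i))) ∧
      (0 < i.val → ¬ Satisfies N u0 (box (r i)))) ∧
  (∀ u, N.rel u0 u → ∀ i j : Fin n, i < j →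
      Satisfies N u (box (r j)) → Satisfies N u (box (r i))) ∧
  (∀ u, N.rel u0 u → ∀ i : Fin n, 0 < i.val →
      (∀ j : Fin n, Satisfies N u (box (r j)) ↔ j < i) →
        ∃ v, N.rel u v ∧ ∀ j : Fin n, Satisfies N v (box (r j)) ↔ j ≤ i)

/-- A (finite) tree order: a partial order with a least element in which the set of
predecessors of every element is linearly ordered. -/
def IsTreeOrder {W : Type} (R : W → W → Prop) : Prop :=
  IsPartialOrder W R ∧ (∃ r, ∀ x, R r x) ∧ ∀ x a b, R a x → R b x → R a b ∨ R b a

/-- A baled tree order: a partial order with a greatest element t whose removal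
leaves a tree. -/
def IsBaledTreeOrder {W : Type} (R : W → W → Prop) : Prop :=
  IsPartialOrder W R ∧ ∃ t : W, (∀ x, R x t) ∧
    (∃ r, r ≠ t ∧ ∀ x, x ≠ t → R r x) ∧
    (∀ x a b, x ≠ t → R a x → R b x → R a b ∨ R b a)

/-- Height of a node: the number of its strict predecessors. -/
noncomputable def heightOf {W : Type} (R : W → W → Prop) (x : W) : ℕ :=
  Nat.card {y : W // R y x ∧ y ≠ x}

/-- y is an immediate successor of x. -/
def ImmSucc {W : Type} (R : W → W → Prop) (x y : W) : Prop :=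
  R x y ∧ x ≠ y ∧ ∀ z, R x z → R z y → z = x ∨ z = y

def IsMaximal {W : Type} (R : W → W → Prop) (x : W) : Prop := ∀ z, R x z → z = x

/-- A regular finite tree: all maximal elements have the same height, and any two
elements of the same height have the same number of immediate successors. -/
def IsRegularTree {W : Type} (R : W → W → Prop) : Prop :=
  IsTreeOrder R ∧
  (∀ x y, IsMaximal R x → IsMaximal R y → heightOf R x = heightOf R y) ∧
  (∀ x y, heightOf R x = heightOf R y →
    Nat.card {z : W // ImmSucc R x z} = Nat.card {z : W // ImmSucc R y z})



/-! ### Soundness -/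

theorem isNormalLogic_generated (Ax : Set Formula) : IsNormalLogic (Generated Ax) where
  taut φ h _ hL := hL.1.taut φ h
  axK φ ψ _ hL := hL.1.axK φ ψ
  mp φ ψ h₁ h₂ L hL := hL.1.mp φ ψ (h₁ L hL) (h₂ L hL)
  nec φ h L hL := hL.1.nec φ (h L hL)
  subst φ σ h L hL := hL.1.subst φ σ (h L hL)

theorem subset_generated (Ax : Set Formula) : Ax ⊆ Generated Ax :=
  fun _ h _ hL => hL.2 h

theorem Tautology.satisfies {W : Type} (M : KripkeModel W) (w : W) {φ : Formula}
    (h : Tautology φ) : Satisfies M w φ := by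
  classical
  have key : ∀ ψ, evalProp (fun χ => decide (Satisfies M w χ)) ψ = true ↔ Satisfies M w ψ := by
    intro ψ
    induction ψ with
    | var n => simp [evalProp]
    | fls => simp [evalProp, Satisfies]
    | impl a b iha ihb =>
      simp only [evalProp, Satisfies, ← iha, ← ihb]
      cases evalProp (fun χ => decide (Satisfies M w χ)) a <;> simp
    | box a => simp [evalProp]
  exact (key φ).1 (h _)

theorem satisfies_subst {W : Type} (M : KripkeModel W) (σ : ℕ → Formula) (φ : Formula) :
    ∀ w, Satisfies M w (φ.subst σ) ↔ Satisfies ⟨M.rel, fun n v => Satisfies M v (σ n)⟩ w φ := by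
  induction φ with
  | var n => intro w; rfl
  | fls => intro w; rfl
  | impl a b iha ihb => intro w; simp only [Formula.subst, Satisfies, iha, ihb]
  | box a iha => intro w; simp only [Formula.subst, Satisfies, iha]

theorem isNormalLogic_validOnFrame (W : Type) (R : W → W → Prop) :
    IsNormalLogic {φ | ValidOnFrame W R φ} where
  taut _ h _ w := Tautology.satisfies _ w h
  axK _ _ _ _ h₁ h₂ v hv := h₁ v hv (h₂ v hv)
  mp _ _ h₁ h₂ val w := h₁ val w (h₂ val w)
  nec _ h val _ v _ := h val v
  subst _ _ h _ _ := (satisfies_subst _ _ _ _).2 (h _ _)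

theorem validOnFrame_axGrz (W : Type) [Finite W] [PartialOrder W] :
    ValidOnFrame W (· ≤ ·) axGrz := by
  intro val w h
  by_contra hp
  obtain ⟨v, hwv, hv⟩ := (Set.toFinite {v | ¬ val 0 v}).exists_le_maximal (a := w) hp
  refine hv.prop (h v hwv fun u hvu hu u' huu' => ?_)
  by_contra hu'
  obtain rfl : u = v := le_antisymm (huu'.trans (hv.le_of_ge hu' (hvu.trans huu'))) hvu
  exact hv.prop hu

theorem validOnFrame_axPoint2 (W : Type) [PartialOrder W] [OrderTop W] :
    ValidOnFrame W (· ≤ ·) axPoint2 := by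
  intro val w h v _ hv
  exact h fun u _ hu => hv ⊤ le_top (hu ⊤ le_top)

theorem validOnFrame_of_mem_Grz2 {φ : Formula} (h : φ ∈ Grz2) (W : Type) [Finite W]
    [PartialOrder W] [OrderTop W] : ValidOnFrame W (· ≤ ·) φ := by
  refine h {ψ | ValidOnFrame W (· ≤ ·) ψ} ⟨isNormalLogic_validOnFrame W _, ?_⟩
  rintro _ (rfl | rfl)
  · exact validOnFrame_axGrz W
  · exact validOnFrame_axPoint2 W

/-! ### The canonical model -/

/-- A set of formulas containing `L` and closed under modus ponens. -/
structure IsTheory (L T : Set Formula) : Prop where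
  subset : L ⊆ T
  mp : ∀ {a b}, impl a b ∈ T → a ∈ T → b ∈ T

/-- A maximal `L`-consistent set: a theory that behaves like a truth set. -/
structure IsWorld (L T : Set Formula) : Prop extends IsTheory L T where
  fls_notMem : fls ∉ T
  impl_mem : ∀ {a b}, (a ∈ T → b ∈ T) → impl a b ∈ T

/-- The canonical accessibility relation. -/
def Sees (Γ Δ : Set Formula) : Prop := ∀ a, box a ∈ Γ → a ∈ Δ

section Canonical

variable {L Γ Δ T : Set Formula} {a b : Formula}

theorem IsTheory.exists_isWorld (hL : IsNormalLogic L) (hT : IsTheory L T) (ha : a ∉ T) :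
    ∃ Γ, IsWorld L Γ ∧ T ⊆ Γ ∧ a ∉ Γ := by
  obtain ⟨Γ, hTΓ, hΓ⟩ := zorn_subset_nonempty {S | IsTheory L S ∧ a ∉ S} (by
    rintro c hc hchain ⟨S₀, hS₀⟩
    refine ⟨⋃₀ c, ⟨⟨fun x hx => ⟨S₀, hS₀, (hc hS₀).1.subset hx⟩, ?_⟩, ?_⟩,
      fun S hS => Set.subset_sUnion_of_mem hS⟩
    · rintro x y ⟨S₁, hS₁, h₁⟩ ⟨S₂, hS₂, h₂⟩
      rcases hchain.total hS₁ hS₂ with h | h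
      · exact ⟨S₂, hS₂, (hc hS₂).1.mp (h h₁) h₂⟩
      · exact ⟨S₁, hS₁, (hc hS₁).1.mp h₁ (h h₂)⟩
    · rintro ⟨S, hS, h⟩
      exact (hc hS).2 h) T ⟨hT, ha⟩
  have hth : IsTheory L Γ := hΓ.prop.1
  have htaut : ∀ x, Tautology x → x ∈ Γ := fun x hx => hth.subset (hL.taut x hx)
  have key : ∀ x, x ∉ Γ → impl x a ∈ Γ := by
    intro x hx
    by_contra hxa
    refine hx (hΓ.le_of_ge (y := {y | impl x y ∈ Γ}) ⟨⟨fun y hy => ?_, fun {y z} h₁ h₂ => ?_⟩, hxa⟩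
      (fun y hy => ?_) (htaut (impl x x) fun v => ?_))
    · exact hth.mp (htaut (impl y (impl x y)) fun v => by
        simp only [evalProp]; cases evalProp v x <;> cases evalProp v y <;> rfl) (hth.subset hy)
    · exact hth.mp (hth.mp (htaut (impl (impl x (impl y z)) (impl (impl x y) (impl x z))) fun v => by
        simp only [evalProp]
        cases evalProp v x <;> cases evalProp v y <;> cases evalProp v z <;> rfl) h₁) h₂
    · exact hth.mp (htaut (impl y (impl x y)) fun v => by
        simp only [evalProp]; cases evalProp v x <;> cases evalProp v y <;> rfl) hy
    · simp only [evalProp]; cases evalProp v x <;> rfl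
  refine ⟨Γ, ⟨hth, fun h => hΓ.prop.2 (hth.mp (htaut (impl fls a) fun v => rfl) h), ?_⟩,
    hTΓ, hΓ.prop.2⟩
  intro x y hxy
  by_cases hx : x ∈ Γ
  · exact hth.mp (htaut (impl y (impl x y)) fun v => by
      simp only [evalProp]; cases evalProp v x <;> cases evalProp v y <;> rfl) (hxy hx)
  · by_contra hn
    refine hΓ.prop.2 (hth.mp (hth.mp
      (htaut (impl (impl x a) (impl (impl (impl x y) a) a)) fun v => ?_) (key x hx)) (key _ hn))
    simp only [evalProp]
    cases evalProp v x <;> cases evalProp v y <;> cases evalProp v a <;> rfl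

theorem IsWorld.neg_mem_iff (hΓ : IsWorld L Γ) : neg a ∈ Γ ↔ a ∉ Γ :=
  ⟨fun h ha => hΓ.fls_notMem (hΓ.mp h ha), fun h => hΓ.impl_mem fun ha => absurd ha h⟩

theorem IsWorld.conj_mem_iff (hΓ : IsWorld L Γ) : conj a b ∈ Γ ↔ a ∈ Γ ∧ b ∈ Γ := by
  unfold conj
  rw [hΓ.neg_mem_iff]
  constructor
  · intro h
    by_contra hab
    exact h (hΓ.impl_mem fun ha => hΓ.neg_mem_iff.2 fun hb => hab ⟨ha, hb⟩)
  · rintro ⟨ha, hb⟩ h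
    exact hΓ.neg_mem_iff.1 (hΓ.mp h ha) hb

theorem IsWorld.exists_sees (hL : IsNormalLogic L) (hΓ : IsWorld L Γ) (h : box a ∉ Γ) :
    ∃ Δ, IsWorld L Δ ∧ Sees Γ Δ ∧ a ∉ Δ :=
  IsTheory.exists_isWorld hL (T := {x | box x ∈ Γ})
    ⟨fun x hx => hΓ.subset (hL.nec x hx),
      fun {x y} h₁ h₂ => hΓ.mp (hΓ.mp (hΓ.subset (hL.axK x y)) h₁) h₂⟩ h

theorem IsWorld.box_mem (hL : IsNormalLogic L) (hΓ : IsWorld L Γ)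
    (h : ∀ Δ, IsWorld L Δ → Sees Γ Δ → a ∈ Δ) : box a ∈ Γ := by
  by_contra hn
  obtain ⟨Δ, hΔ, hs, ha⟩ := hΓ.exists_sees hL hn
  exact ha (h Δ hΔ hs)

theorem IsWorld.dia_mem (hΓ : IsWorld L Γ) (hΔ : IsWorld L Δ) (hs : Sees Γ Δ)
    (h : a ∈ Δ) : dia a ∈ Γ :=
  hΓ.neg_mem_iff.2 fun hb => hΔ.neg_mem_iff.1 (hs _ hb) h

theorem IsWorld.exists_of_dia_mem (hL : IsNormalLogic L) (hΓ : IsWorld L Γ) (h : dia a ∈ Γ) :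
    ∃ Δ, IsWorld L Δ ∧ Sees Γ Δ ∧ a ∈ Δ := by
  obtain ⟨Δ, hΔ, hs, ha⟩ := hΓ.exists_sees hL (hΓ.neg_mem_iff.1 h)
  exact ⟨Δ, hΔ, hs, not_not.1 fun hn => ha (hΔ.neg_mem_iff.2 hn)⟩

/-- The Grzegorczyk axiom as a closure property of worlds. -/
theorem IsWorld.grz (hL : IsNormalLogic L) (hG : axGrz ∈ L) (hΓ : IsWorld L Γ)
    (h : ∀ Δ, IsWorld L Δ → Sees Γ Δ → box (impl a (box a)) ∈ Δ → a ∈ Δ) : a ∈ Γ :=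
  hΓ.mp (hΓ.subset (hL.subst _ (fun _ => a) hG))
    (hΓ.box_mem hL fun Δ hΔ hs => hΔ.impl_mem (h Δ hΔ hs))

theorem IsWorld.of_box_mem (hL : IsNormalLogic L) (hG : axGrz ∈ L) (hΓ : IsWorld L Γ)
    (h : box a ∈ Γ) : a ∈ Γ :=
  hΓ.grz hL hG fun _ _ hs _ => hs _ h

theorem IsWorld.box_box_mem (hL : IsNormalLogic L) (hG : axGrz ∈ L) (hΓ : IsWorld L Γ)
    (h : box a ∈ Γ) : box (box a) ∈ Γ := by
  have hc : conj a (impl (box a) (box (box a))) ∈ Γ := by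
    refine hΓ.grz hL hG fun Δ hΔ hs hA => hΔ.conj_mem_iff.2 ⟨hs _ h, hΔ.impl_mem fun hb => ?_⟩
    refine hΔ.box_mem hL fun E hE hsE => ?_
    by_contra hn
    have hA' := hE.mp (hsE _ hA) (hE.conj_mem_iff.2 ⟨hsE _ hb, hE.impl_mem fun h => absurd h hn⟩)
    exact hn (hE.box_mem hL fun D hD hsD => (hD.conj_mem_iff.1 (hsD _ hA')).1)
  exact hΓ.mp (hΓ.conj_mem_iff.1 hc).2 h

theorem IsWorld.box_mem_of_sees (hL : IsNormalLogic L) (hG : axGrz ∈ L) (hΓ : IsWorld L Γ)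
    (hs : Sees Γ Δ) (h : box a ∈ Γ) : box a ∈ Δ :=
  hs _ (hΓ.box_box_mem hL hG h)

theorem IsWorld.sees_trans {E : Set Formula} (hL : IsNormalLogic L) (hG : axGrz ∈ L)
    (hΓ : IsWorld L Γ) (h₁ : Sees Γ Δ) (h₂ : Sees Δ E) : Sees Γ E :=
  fun _ h => h₂ _ (hΓ.box_mem_of_sees hL hG h₁ h)

theorem IsWorld.exists_sees_grz (hL : IsNormalLogic L) (hG : axGrz ∈ L) (hΓ : IsWorld L Γ)
    (h : box a ∉ Γ) :
    ∃ Δ, IsWorld L Δ ∧ Sees Γ Δ ∧ a ∉ Δ ∧ box (impl a (box a)) ∈ Δ := by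
  by_contra! hn
  refine h (hΓ.box_mem hL fun Δ hΔ hs => hΔ.grz hL hG fun E hE hsE hb => ?_)
  by_contra ha
  exact hn E hE (hΓ.sees_trans hL hG hs hsE) ha hb

/-- With the axiom .2, the part of the canonical frame seen by a world has a top cluster. -/
theorem IsWorld.exists_top (hL : IsNormalLogic L) (hG : axGrz ∈ L) (h2 : axPoint2 ∈ L)
    (hΓ : IsWorld L Γ) :
    ∃ Z, IsWorld L Z ∧ Sees Γ Z ∧ ∀ Δ, IsWorld L Δ → Sees Γ Δ → ∀ a, box a ∈ Δ → box a ∈ Z := by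
  have hrefl : Sees Γ Γ := fun a h => hΓ.of_box_mem hL hG h
  have hT : IsTheory L {a | ∃ Δ, IsWorld L Δ ∧ Sees Γ Δ ∧ box a ∈ Δ} := by
    refine ⟨fun x hx => ⟨Γ, hΓ, hrefl, hΓ.subset (hL.nec x hx)⟩, ?_⟩
    rintro x y ⟨Δ₁, hΔ₁, hs₁, h₁⟩ ⟨Δ₂, hΔ₂, hs₂, h₂⟩
    have hd : box (dia (box (impl x y))) ∈ Γ :=
      hΓ.mp (hΓ.subset (hL.subst _ (fun _ => box (impl x y)) h2))
        (hΓ.dia_mem hΔ₁ hs₁ (hΔ₁.box_box_mem hL hG h₁))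
    obtain ⟨E, hE, hsE, h⟩ := hΔ₂.exists_of_dia_mem hL (hs₂ _ hd)
    exact ⟨E, hE, hΓ.sees_trans hL hG hs₂ hsE,
      hE.mp (hE.mp (hE.subset (hL.axK x y)) h) (hΔ₂.box_mem_of_sees hL hG hsE h₂)⟩
  obtain ⟨Z, hZ, hTZ, -⟩ := hT.exists_isWorld hL (a := fls)
    (by rintro ⟨Δ, hΔ, -, h⟩; exact hΔ.fls_notMem (hΔ.of_box_mem hL hG h))
  exact ⟨Z, hZ, fun a h => hTZ ⟨Γ, hΓ, hrefl, h⟩,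
    fun Δ hΔ hs a h => hTZ ⟨Δ, hΔ, hs, hΔ.box_box_mem hL hG h⟩⟩

end Canonical

/-! ### Finite directed posets -/

/-- The subformulas of a formula. -/
def subformulas : Formula → Set Formula
  | var n => {var n}
  | fls => {fls}
  | impl a b => insert (impl a b) (subformulas a ∪ subformulas b)
  | box a => insert (box a) (subformulas a)

theorem self_mem_subformulas (φ : Formula) : φ ∈ subformulas φ := by
  cases φ <;> simp [subformulas]

theorem finite_subformulas (φ : Formula) : (subformulas φ).Finite := by
  induction φ with
  | var n => exact Set.finite_singleton _
  | fls => exact Set.finite_singleton _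
  | impl a b iha ihb => exact (iha.union ihb).insert _
  | box a iha => exact iha.insert _

/-- The finite set of formulas by which worlds are distinguished. -/
def grzClosure (φ : Formula) : Set Formula :=
  subformulas φ ∪ (fun a => box (impl a (box a))) '' subformulas φ

theorem finite_grzClosure (φ : Formula) : (grzClosure φ).Finite :=
  (finite_subformulas φ).union ((finite_subformulas φ).image _)

/-- The order on `α` in which `x` is strictly below `y` when `g x < g y`. -/
abbrev strictPullback {α β : Type*} [PartialOrder β] (g : α → β) : PartialOrder α where
  le x y := x = y ∨ g x < g y
  le_refl _ := Or.inl rfl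
  le_trans := by
    rintro x y z (rfl | h₁) (rfl | h₂)
    · exact Or.inl rfl
    · exact Or.inr h₂
    · exact Or.inr h₁
    · exact Or.inr (h₁.trans h₂)
  le_antisymm := by
    rintro x y (rfl | h₁) (h | h₂)
    · rfl
    · rfl
    · exact h.symm
    · exact absurd h₂ h₁.asymm

/-- The formulas whose box belongs to a given set. -/
def boxes (s : Set Formula) : Set Formula := {a | box a ∈ s}

/-- The sets of formulas satisfying `P`, as a type carrying no order of its own. -/
structure SetsWith (P : Set Formula → Prop) : Type where
  val : Set Formula
  property : P val

theorem SetsWith.val_injective (P : Set Formula → Prop) :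
    Function.Injective (SetsWith.val : SetsWith P → Set Formula) := by
  rintro ⟨s, _⟩ ⟨t, _⟩ (rfl : s = t)
  rfl

theorem exists_refuting_poset {φ : Formula} (h : φ ∉ Grz2) :
    ∃ (F : Type) (_ : Finite F) (_ : PartialOrder F) (_ : OrderTop F),
      ¬ ValidOnFrame F (· ≤ ·) φ := by
  have hL : IsNormalLogic Grz2 := isNormalLogic_generated _
  have hG : axGrz ∈ Grz2 := subset_generated _ (Or.inl rfl)
  have h2 : axPoint2 ∈ Grz2 := subset_generated _ (Or.inr rfl)
  obtain ⟨Γ, hΓ, -, hφ⟩ := IsTheory.exists_isWorld hL (T := Grz2)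
    ⟨subset_rfl, fun {a b} => hL.mp a b⟩ h
  have hrefl : Sees Γ Γ := fun a h => hΓ.of_box_mem hL hG h
  set X := grzClosure φ with hX
  obtain ⟨Z, hZ, hΓZ, hmax, hZΓ⟩ : ∃ Z, IsWorld Grz2 Z ∧ Sees Γ Z ∧
      (∀ Δ, IsWorld Grz2 Δ → Sees Γ Δ → boxes (Δ ∩ X) ⊆ boxes (Z ∩ X)) ∧
      (Γ = Z ∨ boxes (Γ ∩ X) ≠ boxes (Z ∩ X)) := by
    obtain ⟨Z, hZ, hs, hm⟩ := hΓ.exists_top hL hG h2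
    have hm' : ∀ Δ, IsWorld Grz2 Δ → Sees Γ Δ → boxes (Δ ∩ X) ⊆ boxes (Z ∩ X) :=
      fun Δ hΔ hsΔ a ha => ⟨hm Δ hΔ hsΔ a ha.1, ha.2⟩
    by_cases he : boxes (Γ ∩ X) = boxes (Z ∩ X)
    · exact ⟨Γ, hΓ, hrefl, he ▸ hm', Or.inl rfl⟩
    · exact ⟨Z, hZ, hs, hm', Or.inr he⟩
  let F : Type := SetsWith fun s => ∃ Δ, IsWorld Grz2 Δ ∧ Sees Γ Δ ∧ s = Δ ∩ X ∧
    (s = Z ∩ X ∨ boxes s ≠ boxes (Z ∩ X))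
  have hfin : Finite F := by
    have := (finite_grzClosure φ).powerset.to_subtype
    refine Finite.of_injective (β := 𝒫 (grzClosure φ)) (fun s => ⟨s.val, ?_⟩) ?_
    · obtain ⟨s, Δ, -, -, rfl, -⟩ := s
      exact Set.inter_subset_right
    · intro s t h
      exact SetsWith.val_injective _ (congrArg Subtype.val h)
  let z : F := ⟨Z ∩ X, Z, hZ, hΓZ, rfl, Or.inl rfl⟩
  let g : F → Set Formula := fun s => boxes s.val
  let _ : PartialOrder F := strictPullback g
  let _ : OrderTop F :=
    { top := z
      le_top := by
        rintro ⟨s, Δ, hΔ, hs, rfl, hd⟩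
        rcases hd with hd | hd
        · exact Or.inl (SetsWith.val_injective _ hd)
        · exact Or.inr (lt_of_le_of_ne (hmax Δ hΔ hs) hd) }
  refine ⟨F, hfin, inferInstance, inferInstance, fun hvalid => ?_⟩
  have truth : ∀ ψ, subformulas ψ ⊆ subformulas φ → ∀ s : F,
      Satisfies ⟨(· ≤ ·), fun n s => var n ∈ s.val⟩ s ψ ↔ ψ ∈ s.val := by
    intro ψ
    induction ψ with
    | var n => intro _ s; rfl
    | fls =>
      rintro _ ⟨s, Δ, hΔ, hs, rfl, hd⟩
      exact ⟨False.elim, fun h => hΔ.fls_notMem h.1⟩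
    | impl a b iha ihb =>
      rintro hsub s
      have hmem : impl a b ∈ X := Or.inl (hsub (Set.mem_insert _ _))
      have hsa : subformulas a ⊆ subformulas φ :=
        fun x hx => hsub (Set.mem_insert_of_mem _ (Or.inl hx))
      have hsb : subformulas b ⊆ subformulas φ :=
        fun x hx => hsub (Set.mem_insert_of_mem _ (Or.inr hx))
      have haX : a ∈ X := Or.inl (hsa (self_mem_subformulas a))
      have hbX : b ∈ X := Or.inl (hsb (self_mem_subformulas b))
      simp only [Satisfies]
      rw [iha hsa s, ihb hsb s]
      obtain ⟨s, Δ, hΔ, hs, rfl, hd⟩ := s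
      exact ⟨fun h => ⟨hΔ.impl_mem fun ha => (h ⟨ha, haX⟩).1, hmem⟩,
        fun h ha => ⟨hΔ.mp h.1 ha.1, hbX⟩⟩
    | box a iha =>
      rintro hsub s
      have hsa : subformulas a ⊆ subformulas φ :=
        fun x hx => hsub (Set.mem_insert_of_mem _ hx)
      have haS : a ∈ subformulas φ := hsa (self_mem_subformulas a)
      have haX : a ∈ X := Or.inl haS
      have hbX : box a ∈ X := Or.inl (hsub (Set.mem_insert _ _))
      have hgX : box (impl a (box a)) ∈ X := Or.inr ⟨a, haS, rfl⟩
      simp only [Satisfies, iha hsa]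
      constructor
      · intro hall
        by_contra hns
        have has := hall s le_rfl
        obtain ⟨s, Δ, hΔ, hs, rfl, hd⟩ := s
        have hb : box a ∉ Δ := fun h => hns ⟨h, hbX⟩
        obtain ⟨E, hE, hsE, haE, hgE⟩ := hΔ.exists_sees_grz hL hG hb
        have hΓE := hΓ.sees_trans hL hG hs hsE
        have hlt : boxes (Δ ∩ X) < boxes (E ∩ X) := by
          refine Set.ssubset_iff_exists.2 ⟨fun x hx => ⟨hΔ.box_mem_of_sees hL hG hsE hx.1, hx.2⟩,
            impl a (box a), ⟨hgE, hgX⟩, fun h => hb ?_⟩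
          exact hΔ.mp (hΔ.of_box_mem hL hG h.1) has.1
        by_cases hEZ : boxes (E ∩ X) = boxes (Z ∩ X)
        · have haZ : a ∈ Z := (hall z (Or.inr (hlt.trans_eq hEZ))).1
          have hbZ : box a ∉ Z := fun h => by
            have : a ∈ boxes (E ∩ X) := hEZ ▸ (⟨h, hbX⟩ : a ∈ boxes (Z ∩ X))
            exact haE (hE.of_box_mem hL hG this.1)
          obtain ⟨D, hD, hsD, -, hgD⟩ := hZ.exists_sees_grz hL hG hbZ
          have hgZ := (hmax D hD (hΓ.sees_trans hL hG hΓZ hsD) ⟨hgD, hgX⟩ :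
            impl a (box a) ∈ boxes (Z ∩ X)).1
          exact hbZ (hZ.mp (hZ.of_box_mem hL hG hgZ) haZ)
        · exact haE (hall ⟨E ∩ X, E, hE, hΓE, rfl, Or.inr hEZ⟩ (Or.inr hlt)).1
      · rintro hb t (rfl | hlt)
        · obtain ⟨s, Δ, hΔ, hs, rfl, hd⟩ := s
          exact ⟨hΔ.of_box_mem hL hG hb.1, haX⟩
        · have hbt : box a ∈ t.val := hlt.le hb
          obtain ⟨t, Δ, hΔ, hs, rfl, hd⟩ := t
          exact ⟨hΔ.of_box_mem hL hG hbt.1, haX⟩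
  refine hφ ((truth φ subset_rfl ⟨Γ ∩ X, Γ, hΓ, hrefl, rfl, ?_⟩).1 (hvalid _ _)).1
  exact hZΓ.imp (fun h => by rw [h]) id

/-! ### From directed posets to Boolean algebras -/

theorem satisfies_comp_iff {V W : Type} [Preorder V] [Preorder W] {f : V → W}
    (hf : Monotone f) (hback : ∀ v w, f v ≤ w → ∃ v', v ≤ v' ∧ f v' = w)
    (val : ℕ → W → Prop) (φ : Formula) :
    ∀ v, Satisfies ⟨(· ≤ ·), fun n v => val n (f v)⟩ v φ ↔ Satisfies ⟨(· ≤ ·), val⟩ (f v) φ := by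
  induction φ with
  | var n => intro v; rfl
  | fls => intro v; rfl
  | impl a b iha ihb => intro v; simp only [Satisfies, iha, ihb]
  | box a iha =>
    intro v
    simp only [Satisfies, iha]
    constructor
    · intro h w hw
      obtain ⟨v', hv', rfl⟩ := hback v w hw
      exact h v' hv'
    · intro h v' hv'
      exact h _ (hf hv')

/-- Every finite poset with a top element, rooted at `r`, is a bounded morphic image of the
power set of its set of strictly increasing sequences starting at `r`. -/
theorem exists_boundedMorphism_powerset (F : Type) [Finite F] [PartialOrder F] [OrderTop F]
    (r : F) :
    ∃ (T : Type) (_ : Finite T) (f : Set T → F), Monotone f ∧ f ∅ = r ∧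
      ∀ A y, f A ≤ y → ∃ B, A ≤ B ∧ f B = y := by
  classical
  let T : Type := {l : List F // (r :: l).IsChain (· < ·)}
  have hT : Finite T := by
    have := Fintype.ofFinite F
    refine Finite.of_injective (β := {l : List F // l.Nodup}) (fun l => ⟨l.1, ?_⟩) ?_
    · exact (List.isChain_iff_pairwise.1 l.2).of_cons.imp fun h => h.ne
    · intro l m h
      exact Subtype.ext (congrArg (fun x => x.1) h)
  let nil : T := ⟨[], by simp⟩
  have hlong : ∀ A : Set T, ∃ l ∈ insert nil A, ∀ m ∈ insert nil A, m.1.length ≤ l.1.length :=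
    fun A => Set.exists_max_image _ (fun m : T => m.1.length) (Set.toFinite _) ⟨nil, Or.inl rfl⟩
  choose l hl hlmax using hlong
  let last : T → F := fun m => (r :: m.1).getLast (by simp)
  let f : Set T → F := fun A => if ∀ m ∈ A, m.1 <+: (l A).1 then last (l A) else ⊤
  have hlast : ∀ m n : T, m.1 <+: n.1 → last m ≤ last n := by
    rintro ⟨m, hm⟩ ⟨_, hn⟩ ⟨k, rfl⟩
    have hp : (r :: m ++ k).Pairwise (· < ·) := List.isChain_iff_pairwise.1 hn
    rcases List.eq_nil_or_concat k with rfl | ⟨k, x, rfl⟩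
    · simp [last]
    · refine le_of_lt ?_
      have := (List.pairwise_append.1 hp).2.2 _ (List.getLast_mem (List.cons_ne_nil r m)) x
        (by simp)
      simpa [last] using this
  refine ⟨T, hT, f, ?_, ?_, ?_⟩
  · intro A B hAB
    by_cases hB : ∀ m ∈ B, m.1 <+: (l B).1
    · have hB' : ∀ m ∈ insert nil A, m.1 <+: (l B).1 := by
        rintro m (rfl | hm)
        · exact List.nil_prefix
        · exact hB m (hAB hm)
      have hA : ∀ m ∈ A, m.1 <+: (l A).1 := fun m hm =>
        List.prefix_of_prefix_length_le (hB' m (Or.inr hm)) (hB' _ (hl A))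
          (hlmax A m (Or.inr hm))
      simp only [f, if_pos hA, if_pos hB]
      exact hlast _ _ (hB' _ (hl A))
    · simp only [f, if_neg hB]
      exact le_top
  · have hnil : l ∅ = nil := by simpa using hl ∅
    simp [f, hnil, last, nil]
  · intro A y hy
    by_cases hA : ∀ m ∈ A, m.1 <+: (l A).1
    · rcases eq_or_lt_of_le hy with h | h
      · exact ⟨A, le_rfl, h⟩
      simp only [f, if_pos hA] at h
      let n : T := ⟨(l A).1 ++ [y], by
        rw [← List.cons_append, List.isChain_append]
        refine ⟨(l A).2, by simp, ?_⟩
        intro x hx y' hy'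
        rw [List.getLast?_eq_some_getLast (List.cons_ne_nil r (l A).1)] at hx
        simp only [Option.mem_def, Option.some.injEq, List.head?_cons] at hx hy'
        subst hx hy'
        exact h⟩
      have hpre : ∀ m ∈ insert n A, m.1 <+: n.1 := by
        rintro m (rfl | hm)
        · exact List.prefix_rfl
        · exact (hA m hm).trans (List.prefix_append _ _)
      have hln : l (insert n A) = n := by
        have h₁ : (l (insert n A)).1 <+: n.1 := by
          rcases hl (insert n A) with h | h
          · rw [h]; exact List.nil_prefix
          · exact hpre _ h
        exact Subtype.ext (h₁.eq_of_length_le (hlmax _ n (Or.inr (Or.inl rfl))))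
      refine ⟨insert n A, Set.subset_insert n A, ?_⟩
      simp only [f, hln, if_pos hpre]
      simp [last, n]
    · refine ⟨A, le_rfl, ?_⟩
      simp only [f, if_neg hA] at hy ⊢
      exact (top_le_iff.1 hy).symm

/-- Grz.2 is characterized by the class of all finite Boolean algebras. -/
theorem statement16 (φ : Formula) :
    φ ∈ Grz2 ↔ ∀ (W : Type) [Finite W] [BooleanAlgebra W], ValidOnFrame W (· ≤ ·) φ := by
  refine ⟨fun h W _ _ => validOnFrame_of_mem_Grz2 h W, fun h => ?_⟩
  by_contra hφ
  obtain ⟨F, _, _, _, hF⟩ := exists_refuting_poset hφ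
  refine hF fun val r => ?_
  obtain ⟨T, _, f, hmono, rfl, hback⟩ := exists_boundedMorphism_powerset F r
  exact (satisfies_comp_iff hmono hback val φ ∅).1 (h (Set T) _ _)

end GrzPaper
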